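/- arXiv:2103.14012 — 3 statements merged into one kernel-verified Lean document; each statement's English description precedes it below -/
import Mathlib

section
/- Let f, g, and h be non-negative Borel measurable functions on ℝⁿ vanishing at infinity (i.e., the Lebesgue measure of {x : f(x) > t} is finite for every t > 0, and likewise for g and h). Then ∫_{ℝⁿ} f(x) g(x) h(x) dx ≤ ∫_{ℝⁿ} f*(x) g*(x) h*(x) dx, where f*, g*, h* denote the symmetric decreasing rearrangements of f, g, h. -/
open MeasureTheory ENNReal

/-- `fs` is the symmetric decreasing rearrangement of the non-negative function `f` on ℝⁿ:
for every `t > 0`, the superlevel set `{fs > t}` is an open ball centered at the origin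
whose Lebesgue measure equals that of `{f > t}`. -/
def IsSymmDecrRearrangement {n : ℕ}
    (f fs : EuclideanSpace ℝ (Fin n) → ℝ≥0∞) : Prop :=
  ∀ t : ℝ≥0∞, 0 < t → ∃ r : ℝ,
    {x | t < fs x} = Metric.ball (0 : EuclideanSpace ℝ (Fin n)) r ∧
    volume (Metric.ball (0 : EuclideanSpace ℝ (Fin n)) r) = volume {x | t < f x}

/-- The layer cake representation of an extended non-negative number. -/
theorem lintegral_Ioi_indicator_ofReal_lt (a : ℝ≥0∞) :
    ∫⁻ t in Set.Ioi (0 : ℝ), {t : ℝ | ENNReal.ofReal t < a}.indicator 1 t = a := by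
  have hm : MeasurableSet {t : ℝ | ENNReal.ofReal t < a} :=
    measurableSet_lt ENNReal.measurable_ofReal measurable_const
  rw [lintegral_indicator_one hm, Measure.restrict_apply hm]
  induction a with
  | top => simp
  | coe a =>
    have : {t : ℝ | ENNReal.ofReal t < a} ∩ Set.Ioi 0 = Set.Ioo 0 (a : ℝ) := by
      ext t
      simp only [Set.mem_inter_iff, Set.mem_ofPred_eq, Set.mem_Ioi, Set.mem_Ioo]
      rw [and_comm]
      refine and_congr_right fun ht => ?_
      rw [← ENNReal.ofReal_coe_nnreal, ENNReal.ofReal_lt_ofReal_iff_of_nonneg ht.le]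
    rw [this]
    simp

/-- Weighted layer cake formula for functions with values in `[0, ∞]`. -/
theorem lintegral_mul_eq_lintegral_superlevel {α : Type*} [MeasurableSpace α] (μ : Measure α)
    [SFinite μ] {f g : α → ℝ≥0∞} (hf : Measurable f) (hg : Measurable g) :
    ∫⁻ x, f x * g x ∂μ =
      ∫⁻ t in Set.Ioi (0 : ℝ), ∫⁻ x in {x | ENNReal.ofReal t < f x}, g x ∂μ := by
  have hs : MeasurableSet {p : α × ℝ | ENNReal.ofReal p.2 < f p.1} :=
    measurableSet_lt (ENNReal.measurable_ofReal.comp measurable_snd) (hf.comp measurable_fst)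
  have hsm : Measurable ({p : α × ℝ | ENNReal.ofReal p.2 < f p.1}.indicator fun p => g p.1) :=
    (hg.comp measurable_fst).indicator hs
  calc ∫⁻ x, f x * g x ∂μ
      = ∫⁻ x, (∫⁻ t in Set.Ioi (0 : ℝ),
          {p : α × ℝ | ENNReal.ofReal p.2 < f p.1}.indicator (fun p => g p.1) (x, t)) ∂μ := by
        refine lintegral_congr fun x => ?_
        have hm : MeasurableSet {t : ℝ | ENNReal.ofReal t < f x} :=
          measurableSet_lt ENNReal.measurable_ofReal measurable_const
        conv_lhs => rw [← lintegral_Ioi_indicator_ofReal_lt (f x)]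
        rw [← lintegral_mul_const _ (measurable_one.indicator hm)]
        refine lintegral_congr fun t => ?_
        by_cases h : ENNReal.ofReal t < f x <;> simp [h]
    _ = ∫⁻ t in Set.Ioi (0 : ℝ), ∫⁻ x,
          {p : α × ℝ | ENNReal.ofReal p.2 < f p.1}.indicator (fun p => g p.1) (x, t) ∂μ :=
        lintegral_lintegral_swap hsm.aemeasurable
    _ = _ := by
        refine lintegral_congr fun t => ?_
        rw [← lintegral_indicator (measurableSet_lt measurable_const hf)]
        rfl

/-- The integral of a product of three functions in terms of their superlevel sets. -/
theorem lintegral_mul_mul_eq_lintegral_superlevel {α : Type*} [MeasurableSpace α]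
    (μ : Measure α) [SFinite μ] {f g h : α → ℝ≥0∞}
    (hf : Measurable f) (hg : Measurable g) (hh : Measurable h) :
    ∫⁻ x, f x * g x * h x ∂μ =
      ∫⁻ t in Set.Ioi (0 : ℝ), ∫⁻ s in Set.Ioi (0 : ℝ), ∫⁻ u in Set.Ioi (0 : ℝ),
        μ ({x | ENNReal.ofReal u < h x} ∩
          ({x | ENNReal.ofReal s < g x} ∩ {x | ENNReal.ofReal t < f x})) := by
  simp_rw [mul_assoc]
  refine (lintegral_mul_eq_lintegral_superlevel μ hf (hg.mul hh)).trans ?_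
  refine lintegral_congr fun t => ?_
  simp_rw [Pi.mul_apply]
  rw [lintegral_mul_eq_lintegral_superlevel _ hg hh]
  refine lintegral_congr fun s => ?_
  rw [Measure.restrict_restrict (measurableSet_lt measurable_const hg)]
  have key := lintegral_mul_eq_lintegral_superlevel
    (μ.restrict ({x | ENNReal.ofReal s < g x} ∩ {x | ENNReal.ofReal t < f x})) hh
    (measurable_const (a := (1 : ℝ≥0∞)))
  simp only [mul_one] at key
  rw [key]
  refine lintegral_congr fun u => ?_
  rw [setLIntegral_one, Measure.restrict_apply (measurableSet_lt measurable_const hh)]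

theorem IsSymmDecrRearrangement.measurable {n : ℕ} {f fs : EuclideanSpace ℝ (Fin n) → ℝ≥0∞}
    (hfs : IsSymmDecrRearrangement f fs) : Measurable fs := by
  have hpos : ∀ t : ℝ≥0∞, 0 < t → IsOpen {x | t < fs x} := fun t ht => by
    obtain ⟨r, hr, -⟩ := hfs t ht
    exact hr ▸ Metric.isOpen_ball
  refine measurable_of_Ioi fun t => IsOpen.measurableSet ?_
  have : fs ⁻¹' Set.Ioi t = ⋃ s ∈ Set.Ioi t, {x | s < fs x} := by
    ext x
    simp only [Set.mem_preimage, Set.mem_Ioi, Set.mem_iUnion, Set.mem_ofPred_eq, exists_prop]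
    exact ⟨exists_between, fun ⟨s, h₁, h₂⟩ => h₁.trans h₂⟩
  rw [this]
  exact isOpen_biUnion fun s hs => hpos s (pos_of_gt hs)

/-- Balls with a common center are nested, so they maximize the measure of an intersection among
sets of given measures. -/
theorem measure_inter_inter_le_measure_ball_inter_inter {X : Type*} [PseudoMetricSpace X]
    [MeasurableSpace X] (μ : Measure X) (x : X) {A B C : Set X} {a b c : ℝ}
    (hA : μ (Metric.ball x a) = μ A) (hB : μ (Metric.ball x b) = μ B)
    (hC : μ (Metric.ball x c) = μ C) :
    μ (A ∩ (B ∩ C)) ≤ μ (Metric.ball x a ∩ (Metric.ball x b ∩ Metric.ball x c)) := by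
  have hball : ∀ r s : ℝ,
      Metric.ball x r ∩ Metric.ball x s = Metric.ball x (min r s) := fun r s => by
    ext y
    simp
  rw [hball, hball]
  rcases min_choice a (min b c) with h | h
  · rw [h, hA]
    exact measure_mono Set.inter_subset_left
  · rw [h]
    rcases min_choice b c with h' | h'
    · rw [h', hB]
      exact measure_mono fun _ hy => hy.2.1
    · rw [h', hC]
      exact measure_mono fun _ hy => hy.2.2

/-- **Hardy–Littlewood inequality for three functions.**
For non-negative Borel measurable functions `f, g, h` on ℝⁿ vanishing at infinity, with
symmetric decreasing rearrangements `fs, gs, hs`,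
`∫ f g h dx ≤ ∫ fs gs hs dx` (integrals in `[0, ∞]`, w.r.t. Lebesgue measure). -/
theorem hardy_littlewood_three_functions {n : ℕ}
    (f g h fs gs hs : EuclideanSpace ℝ (Fin n) → ℝ≥0∞)
    (hf : Measurable f) (hg : Measurable g) (hh : Measurable h)
    (hfv : ∀ t : ℝ≥0∞, 0 < t → volume {x | t < f x} < ∞)
    (hgv : ∀ t : ℝ≥0∞, 0 < t → volume {x | t < g x} < ∞)
    (hhv : ∀ t : ℝ≥0∞, 0 < t → volume {x | t < h x} < ∞)
    (hfs : IsSymmDecrRearrangement f fs)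
    (hgs : IsSymmDecrRearrangement g gs)
    (hhs : IsSymmDecrRearrangement h hs) :
    ∫⁻ x, f x * g x * h x ∂volume ≤ ∫⁻ x, fs x * gs x * hs x ∂volume := by
  rw [lintegral_mul_mul_eq_lintegral_superlevel volume hf hg hh,
    lintegral_mul_mul_eq_lintegral_superlevel volume hfs.measurable hgs.measurable hhs.measurable]
  refine setLIntegral_mono' measurableSet_Ioi fun t ht => ?_
  refine setLIntegral_mono' measurableSet_Ioi fun s hs => ?_
  refine setLIntegral_mono' measurableSet_Ioi fun u hu => ?_
  obtain ⟨a, ha, ha'⟩ := hfs _ (ENNReal.ofReal_pos.2 ht)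
  obtain ⟨b, hb, hb'⟩ := hgs _ (ENNReal.ofReal_pos.2 hs)
  obtain ⟨c, hc, hc'⟩ := hhs _ (ENNReal.ofReal_pos.2 hu)
  rw [ha, hb, hc]
  exact measure_inter_inter_le_measure_ball_inter_inter volume 0 hc' hb' ha'
end

section
/- Let B^r ⊆ ℝⁿ denote the closed ball of radius r centered at the origin, and let f and g be non-negative Borel measurable integrable functions on ℝⁿ satisfying ∫_{B^r} f(x) dx ≤ ∫_{B^r} g(x) dx for all r ≥ 0. Then ∫_{ℝⁿ} h(x) f(x) dx ≤ ∫_{ℝⁿ} h(x) g(x) dx for every non-negative symmetric decreasing Borel measurable function h on ℝⁿ, where the integrals are understood in [0, ∞]. -/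
open MeasureTheory ENNReal

/-- A non-negative function on ℝⁿ (valued in `[0, ∞]`) is symmetric decreasing if its value
depends only on the Euclidean norm and is non-increasing in the norm. -/
def SymmetricDecreasing {n : ℕ} (h : EuclideanSpace ℝ (Fin n) → ℝ≥0∞) : Prop :=
  ∀ x y : EuclideanSpace ℝ (Fin n), ‖x‖ ≤ ‖y‖ → h y ≤ h x

/-- If `μ` is dominated by `ν` on all closed balls centered at the origin, then it is dominated
by `ν` on every set that is downward closed with respect to the norm. -/
theorem measure_le_of_closedBall_le {E : Type*} [SeminormedAddCommGroup E] [MeasurableSpace E]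
    {μ ν : Measure E}
    (hμν : ∀ r : ℝ, 0 ≤ r → μ (Metric.closedBall 0 r) ≤ ν (Metric.closedBall 0 r))
    {s : Set E} (hs : ∀ x y : E, ‖x‖ ≤ ‖y‖ → y ∈ s → x ∈ s) : μ s ≤ ν s := by
  by_cases hmax : ∃ y ∈ s, ∀ z ∈ s, ‖z‖ ≤ ‖y‖
  · obtain ⟨y, hy, hmax⟩ := hmax
    have hsy : s = Metric.closedBall 0 ‖y‖ := by
      ext z
      rw [mem_closedBall_zero_iff]
      exact ⟨hmax z, fun hz => hs z y hz hy⟩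
    rw [hsy]
    exact hμν _ (norm_nonneg y)
  · push Not at hmax
    let Q : Set ℚ := {q | 0 ≤ q ∧ Metric.closedBall (0 : E) q ⊆ s}
    have hsQ : s = ⋃ q ∈ Q, Metric.closedBall (0 : E) q := by
      apply Set.Subset.antisymm
      · intro y hy
        obtain ⟨z, hz, hyz⟩ := hmax y hy
        obtain ⟨q, hyq, hqz⟩ := exists_rat_btwn hyz
        refine Set.mem_iUnion₂.2 ⟨q, ⟨?_, fun w hw => ?_⟩, ?_⟩
        · exact_mod_cast (norm_nonneg y).trans hyq.le
        · exact hs w z ((mem_closedBall_zero_iff.1 hw).trans hqz.le) hz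
        · exact mem_closedBall_zero_iff.2 hyq.le
      · exact Set.iUnion₂_subset fun q hq => hq.2
    have hdir : DirectedOn (Function.onFun (· ⊆ ·) fun q : ℚ => Metric.closedBall (0 : E) q) Q := by
      have hmono : Monotone fun q : ℚ => Metric.closedBall (0 : E) q := fun p q hpq =>
        Metric.closedBall_subset_closedBall (by exact_mod_cast hpq)
      intro p hp q hq
      rcases le_total p q with hpq | hqp
      · exact ⟨q, hq, hmono hpq, subset_rfl⟩
      · exact ⟨p, hp, subset_rfl, hmono hqp⟩
    rw [hsQ, measure_biUnion_eq_iSup Q.to_countable hdir,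
      measure_biUnion_eq_iSup Q.to_countable hdir]
    exact iSup₂_mono fun q hq => hμν q (by exact_mod_cast hq.1)

/-- If `μ` is dominated by `ν` on all closed balls centered at the origin, then integrals of
symmetric decreasing functions against `μ` are dominated by those against `ν`. -/
theorem SymmetricDecreasing.lintegral_le {n : ℕ} {μ ν : Measure (EuclideanSpace ℝ (Fin n))}
    (hμν : ∀ r : ℝ, 0 ≤ r → μ (Metric.closedBall 0 r) ≤ ν (Metric.closedBall 0 r))
    {h : EuclideanSpace ℝ (Fin n) → ℝ≥0∞} (hm : Measurable h) (hh : SymmetricDecreasing h) :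
    ∫⁻ x, h x ∂μ ≤ ∫⁻ x, h x ∂ν := by
  have htrunc (k : ℕ) : ∫⁻ x, min (h x) k ∂μ ≤ ∫⁻ x, min (h x) k ∂ν := by
    have hne (x) : min (h x) (k : ℝ≥0∞) ≠ ∞ :=
      ne_top_of_le_ne_top (natCast_ne_top k) (min_le_right _ _)
    have hmeas : Measurable fun x => (min (h x) (k : ℝ≥0∞)).toReal :=
      (hm.min measurable_const).ennreal_toReal
    have hlayer (ρ : Measure (EuclideanSpace ℝ (Fin n))) :
        ∫⁻ x, min (h x) k ∂ρ =
          ∫⁻ t in Set.Ioi 0, ρ {x | t < (min (h x) (k : ℝ≥0∞)).toReal} := by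
      rw [← lintegral_eq_lintegral_meas_lt ρ (.of_forall fun _ => toReal_nonneg)
        hmeas.aemeasurable]
      simp only [ofReal_toReal (hne _)]
    rw [hlayer μ, hlayer ν]
    refine lintegral_mono fun t => measure_le_of_closedBall_le hμν fun x y hxy hy => ?_
    exact lt_of_lt_of_le hy (toReal_mono (hne x) (min_le_min_right _ (hh x y hxy)))
  have hsup : h = fun x => ⨆ k : ℕ, min (h x) k := by
    funext x
    rw [← inf_iSup_eq, iSup_natCast, inf_top_eq]
  have hmono : Monotone fun (k : ℕ) x => min (h x) (k : ℝ≥0∞) := fun i j hij x =>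
    min_le_min_left _ (by exact_mod_cast hij)
  rw [hsup, lintegral_iSup (fun k => hm.min measurable_const) hmono,
    lintegral_iSup (fun k => hm.min measurable_const) hmono]
  exact iSup_mono htrunc

/-- If `f, g` are non-negative Borel measurable integrable functions on ℝⁿ
with `∫_{B^r} f ≤ ∫_{B^r} g` over every closed ball `B^r` of radius `r ≥ 0` centered at the
origin, then `∫ h f ≤ ∫ h g` (in `[0, ∞]`) for every non-negative symmetric decreasing
Borel measurable function `h`. -/
theorem integral_le_of_ball_integral_le {n : ℕ}
    (f g : EuclideanSpace ℝ (Fin n) → ℝ)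
    (hf0 : ∀ x, 0 ≤ f x) (hg0 : ∀ x, 0 ≤ g x)
    (hfm : Measurable f) (hgm : Measurable g)
    (hfi : Integrable f volume) (hgi : Integrable g volume)
    (hball : ∀ r : ℝ, 0 ≤ r →
      ∫ x in Metric.closedBall (0 : EuclideanSpace ℝ (Fin n)) r, f x ∂volume
        ≤ ∫ x in Metric.closedBall (0 : EuclideanSpace ℝ (Fin n)) r, g x ∂volume) :
    ∀ h : EuclideanSpace ℝ (Fin n) → ℝ≥0∞,
      Measurable h → SymmetricDecreasing h →
      ∫⁻ x, h x * ENNReal.ofReal (f x) ∂volume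
        ≤ ∫⁻ x, h x * ENNReal.ofReal (g x) ∂volume := by
  intro h hm hh
  have hdensity (u : EuclideanSpace ℝ (Fin n) → ℝ) (hu : Measurable u) :
      ∫⁻ x, h x * ENNReal.ofReal (u x) ∂volume =
        ∫⁻ x, h x ∂volume.withDensity fun x => ENNReal.ofReal (u x) := by
    rw [lintegral_withDensity_eq_lintegral_mul _ hu.ennreal_ofReal hm]
    simp only [Pi.mul_apply, mul_comm]
  rw [hdensity f hfm, hdensity g hgm]
  refine hh.lintegral_le (fun r hr => ?_) hm
  rw [withDensity_apply _ Metric.isClosed_closedBall.measurableSet,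
    withDensity_apply _ Metric.isClosed_closedBall.measurableSet,
    ← ofReal_integral_eq_lintegral_ofReal hfi.integrableOn (.of_forall hf0),
    ← ofReal_integral_eq_lintegral_ofReal hgi.integrableOn (.of_forall hg0)]
  exact ofReal_le_ofReal (hball r hr)
end

section
/- Let (Ω, F, P) be a probability space and G ⊆ F a sub-σ-algebra. Let x be an ℝⁿ-valued random vector whose conditional distribution given G is Gaussian with G-measurable mean vector x̌ and deterministic covariance matrix Y ⪰ 0. Let w be Gaussian on ℝⁿ with zero mean and covariance W ≻ 0 and v Gaussian on ℝᵖ with zero mean and covariance V ≻ 0, such that w, v, and the pair (σ(G), x) are mutually independent. Let u be a G-measurable ℝᵐ-valued random vector, and define x' = A x + B u + w and y = C x' + v for matrices A ∈ ℝ^{n×n}, B ∈ ℝ^{n×m}, C ∈ ℝ^{p×n}. Then the innovation ν = y − C(A x̌ + B u) is independent of G and is Gaussian with zero mean and covariance C (A Y A^T + W) C^T + V. -/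
open MeasureTheory ProbabilityTheory Matrix

/-- A probability measure on ℝᵈ is Gaussian with mean `m` and covariance `Sig` iff its
characteristic function is `t ↦ exp(i⟨t, m⟩ − ⟨t, Sig t⟩ / 2)`. -/
def IsGaussianMeasure {d : ℕ} (ν : Measure (Fin d → ℝ)) (m : Fin d → ℝ)
    (Sig : Matrix (Fin d) (Fin d) ℝ) : Prop :=
  IsProbabilityMeasure ν ∧
    ∀ t : Fin d → ℝ,
      ∫ z, Complex.exp (Complex.I * ((t ⬝ᵥ z : ℝ) : ℂ)) ∂ν
        = Complex.exp (Complex.I * ((t ⬝ᵥ m : ℝ) : ℂ)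
            - (1 / 2 : ℂ) * ((t ⬝ᵥ (Sig *ᵥ t) : ℝ) : ℂ))

theorem ProbabilityTheory.iIndep.iIndepFun_of_measurable {Ω ι β : Type*} {mΩ : MeasurableSpace Ω}
    [MeasurableSpace β] {μ : Measure Ω} {m : ι → MeasurableSpace Ω} (h : iIndep m μ)
    {f : ι → Ω → β} (hf : ∀ i, Measurable[m i] (f i)) : iIndepFun f μ := by
  rw [iIndepFun_iff_iIndep, iIndep_iff]
  intro S s hs
  exact h.meas_biInter fun i hi => (hf i).comap_le _ (hs i hi)

/-- Three complex random variables measurable with respect to independent σ-algebras have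
multiplicative expectation. -/
theorem ProbabilityTheory.iIndep.integral_mul_mul {Ω : Type*}
    {m₁ m₂ m₃ mΩ : MeasurableSpace Ω} {μ : Measure Ω} (h : iIndep ![m₁, m₂, m₃] μ)
    (h₁ : m₁ ≤ mΩ) (h₂ : m₂ ≤ mΩ) (h₃ : m₃ ≤ mΩ) {f₁ f₂ f₃ : Ω → ℂ}
    (hf₁ : Measurable[m₁] f₁) (hf₂ : Measurable[m₂] f₂) (hf₃ : Measurable[m₃] f₃) :
    ∫ ω, f₁ ω * f₂ ω * f₃ ω ∂μ = (∫ ω, f₁ ω ∂μ) * (∫ ω, f₂ ω ∂μ) * ∫ ω, f₃ ω ∂μ := by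
  have hind : iIndepFun ![f₁, f₂, f₃] μ :=
    h.iIndepFun_of_measurable (Fin.forall_fin_succ.2
      ⟨hf₁, Fin.forall_fin_succ.2 ⟨hf₂, Fin.forall_fin_succ.2 ⟨hf₃, fun i => i.elim0⟩⟩⟩)
  have hmeas : ∀ i, AEStronglyMeasurable (![f₁, f₂, f₃] i) μ := Fin.forall_fin_succ.2
    ⟨(hf₁.mono h₁ le_rfl).aestronglyMeasurable, Fin.forall_fin_succ.2
      ⟨(hf₂.mono h₂ le_rfl).aestronglyMeasurable, Fin.forall_fin_succ.2
        ⟨(hf₃.mono h₃ le_rfl).aestronglyMeasurable, fun i => i.elim0⟩⟩⟩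
  simpa [Fin.prod_univ_three] using hind.integral_fun_prod_eq_prod_integral hmeas

theorem MeasureTheory.setIntegral_mul_condExp {Ω : Type*} {m mΩ : MeasurableSpace Ω}
    {μ : Measure Ω} (hm : m ≤ mΩ) [SigmaFinite (μ.trim hm)]
    {f g : Ω → ℂ} (hf : StronglyMeasurable[m] f) (hg : Integrable g μ)
    (hfg : Integrable (fun ω => f ω * g ω) μ) {s : Set Ω} (hs : MeasurableSet[m] s) :
    ∫ ω in s, f ω * g ω ∂μ = ∫ ω in s, f ω * (μ[g | m]) ω ∂μ := by
  rw [← setIntegral_condExp hm hfg hs]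
  refine setIntegral_congr_ae (hm s hs) ?_
  filter_upwards [condExp_bilin_of_stronglyMeasurable_left (.mul ℝ ℂ) hf hfg hg] with ω hω _
  exact hω

/-- Finite measures on `Fin d → ℝ` are determined by their characteristic functions. -/
theorem MeasureTheory.Measure.ext_of_integral_cexp_dotProduct {d : ℕ}
    {μ₁ μ₂ : Measure (Fin d → ℝ)} [IsFiniteMeasure μ₁] [IsFiniteMeasure μ₂]
    (h : ∀ t : Fin d → ℝ, ∫ z, Complex.exp (Complex.I * ((t ⬝ᵥ z : ℝ) : ℂ)) ∂μ₁
      = ∫ z, Complex.exp (Complex.I * ((t ⬝ᵥ z : ℝ) : ℂ)) ∂μ₂) : μ₁ = μ₂ := by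
  refine Measure.ext_of_charFunDual (funext fun L => ?_)
  obtain ⟨t, ht⟩ : ∃ t : Fin d → ℝ, ∀ z, L z = t ⬝ᵥ z :=
    ⟨fun i => L fun j => if i = j then 1 else 0, fun z => by
      simpa [dotProduct, mul_comm]
        using LinearMap.pi_apply_eq_sum_univ (L : (Fin d → ℝ) →ₗ[ℝ] ℝ) z⟩
  simpa only [charFunDual_apply, ht, mul_comm Complex.I] using h t

theorem integrable_cexp_I_mul {Ω : Type*} {mΩ : MeasurableSpace Ω} {μ : Measure Ω}
    [IsFiniteMeasure μ] {f : Ω → ℝ} (hf : Measurable f) :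
    Integrable (fun ω => Complex.exp (Complex.I * (f ω : ℂ))) μ := by
  refine Integrable.of_bound (by fun_prop) 1 (ae_of_all _ fun ω => ?_)
  rw [mul_comm, Complex.norm_exp_ofReal_mul_I]

theorem Measurable.dotProduct_const_left {Ω ι : Type*} [Fintype ι] {mΩ : MeasurableSpace Ω}
    {f : Ω → ι → ℝ} (hf : Measurable f) (t : ι → ℝ) : Measurable fun ω => t ⬝ᵥ f ω := by
  unfold dotProduct
  fun_prop

theorem IsGaussianMeasure.integral_comp {Ω : Type*} {mΩ : MeasurableSpace Ω} {μ : Measure Ω}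
    {d : ℕ} {f : Ω → Fin d → ℝ} (hf : Measurable f) {S : Matrix (Fin d) (Fin d) ℝ}
    (h : IsGaussianMeasure (μ.map f) 0 S) (t : Fin d → ℝ) :
    ∫ ω, Complex.exp (Complex.I * ((t ⬝ᵥ f ω : ℝ) : ℂ)) ∂μ
      = Complex.exp (-(1 / 2 : ℂ) * ((t ⬝ᵥ (S *ᵥ t) : ℝ) : ℂ)) := by
  have := h.2 t
  rw [integral_map hf.aemeasurable (by
    have := (measurable_id (α := Fin d → ℝ)).dotProduct_const_left t
    exact Measurable.aestronglyMeasurable (by fun_prop))] at this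
  rw [this]
  simp

/-- If the characteristic function of `f` on every event of `G` is the probability of this event
times that of a Gaussian, then `f` is Gaussian and independent of `G`. -/
theorem indep_and_isGaussianMeasure_of_setIntegral {Ω : Type*} {G mΩ : MeasurableSpace Ω}
    {μ : Measure Ω} [IsProbabilityMeasure μ] {d : ℕ}
    {f : Ω → Fin d → ℝ} (hf : Measurable f) {S : Matrix (Fin d) (Fin d) ℝ}
    (h : ∀ (t : Fin d → ℝ) (s : Set Ω), MeasurableSet[G] s →
      ∫ ω in s, Complex.exp (Complex.I * ((t ⬝ᵥ f ω : ℝ) : ℂ)) ∂μ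
        = μ.real s * Complex.exp (-(1 / 2 : ℂ) * ((t ⬝ᵥ (S *ᵥ t) : ℝ) : ℂ))) :
    Indep (MeasurableSpace.comap f inferInstance) G μ ∧ IsGaussianMeasure (μ.map f) 0 S := by
  have hexp : ∀ t : Fin d → ℝ,
      Measurable fun z : Fin d → ℝ => Complex.exp (Complex.I * ((t ⬝ᵥ z : ℝ) : ℂ)) := fun t => by
    have := (measurable_id (α := Fin d → ℝ)).dotProduct_const_left t
    fun_prop
  have huniv : ∀ t : Fin d → ℝ, ∫ z, Complex.exp (Complex.I * ((t ⬝ᵥ z : ℝ) : ℂ)) ∂(μ.map f)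
      = Complex.exp (-(1 / 2 : ℂ) * ((t ⬝ᵥ (S *ᵥ t) : ℝ) : ℂ)) := fun t => by
    rw [integral_map hf.aemeasurable (hexp t).aestronglyMeasurable]
    simpa using h t Set.univ MeasurableSet.univ
  refine ⟨?_, Measure.isProbabilityMeasure_map hf.aemeasurable, fun t => ?_⟩
  · rw [Indep_iff]
    rintro _ s ⟨D, hD, rfl⟩ hs
    have hmap : (μ.restrict s).map f = μ s • μ.map f := by
      have : IsFiniteMeasure (μ s • μ.map f) := Measure.smul_finite _ (measure_ne_top μ s)
      refine Measure.ext_of_integral_cexp_dotProduct fun t => ?_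
      rw [integral_map hf.aemeasurable (hexp t).aestronglyMeasurable, h t s hs,
        integral_smul_measure, huniv t]
      simp [Measure.real]
    have := congrArg (fun ρ => ρ D) hmap
    simp only [Measure.map_apply hf hD, Measure.smul_apply, smul_eq_mul,
      Measure.restrict_apply (hf hD)] at this
    rw [this, mul_comm]
  · rw [huniv t]
    simp

/-- Let the conditional distribution of `x` given the sub-σ-algebra `G` be
Gaussian with `G`-measurable mean `x̌` and deterministic covariance `Y ⪰ 0` (expressed via
the conditional characteristic function), let `w ∼ N(0, W)`, `W ≻ 0`, and `v ∼ N(0, V)`,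
`V ≻ 0` be such that `w`, `v`, `(σ(G), x)` are mutually independent, let `u` be
`G`-measurable, and set `x' = A x + B u + w`, `y = C x' + v`. Then the innovation
`ν = y − C (A x̌ + B u)` is independent of `G` and Gaussian with zero mean and covariance
`C (A Y Aᵀ + W) Cᵀ + V`. -/
theorem innovation_independent_gaussian
    {Ω : Type*} {F : MeasurableSpace Ω} (μ : Measure Ω) [IsProbabilityMeasure μ]
    {G : MeasurableSpace Ω} (hG : G ≤ F)
    {n m p : ℕ}
    (A : Matrix (Fin n) (Fin n) ℝ) (B : Matrix (Fin n) (Fin m) ℝ)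
    (C : Matrix (Fin p) (Fin n) ℝ)
    (W : Matrix (Fin n) (Fin n) ℝ) (V : Matrix (Fin p) (Fin p) ℝ)
    (hW : W.PosDef) (hV : V.PosDef)
    (x : Ω → Fin n → ℝ) (hxm : Measurable[F] x)
    (xc : Ω → Fin n → ℝ) (hxcm : Measurable[G] xc)
    (Y : Matrix (Fin n) (Fin n) ℝ) (hY : Y.PosSemidef)
    -- the conditional distribution of `x` given `G` is Gaussian with mean `x̌ = xc` and
    -- covariance `Y`, expressed through the conditional characteristic function
    (hxGauss : ∀ t : Fin n → ℝ,
      (μ[fun ω => Complex.exp (Complex.I * ((t ⬝ᵥ x ω : ℝ) : ℂ)) | G]) =ᵐ[μ]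
        fun ω => Complex.exp (Complex.I * ((t ⬝ᵥ xc ω : ℝ) : ℂ)
          - (1 / 2 : ℂ) * ((t ⬝ᵥ (Y *ᵥ t) : ℝ) : ℂ)))
    (w : Ω → Fin n → ℝ) (hwm : Measurable[F] w)
    (hwGauss : IsGaussianMeasure (@Measure.map Ω (Fin n → ℝ) F _ w μ) 0 W)
    (v : Ω → Fin p → ℝ) (hvm : Measurable[F] v)
    (hvGauss : IsGaussianMeasure (@Measure.map Ω (Fin p → ℝ) F _ v μ) 0 V)
    -- `w`, `v`, and the pair `(σ(G), x)` are mutually independent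
    (hindep : iIndep (_mΩ := F)
      ![MeasurableSpace.comap w inferInstance,
        MeasurableSpace.comap v inferInstance,
        G ⊔ MeasurableSpace.comap x inferInstance] μ)
    (u : Ω → Fin m → ℝ) (humG : Measurable[G] u)
    (x' : Ω → Fin n → ℝ) (hx' : ∀ ω, x' ω = A *ᵥ x ω + B *ᵥ u ω + w ω)
    (y : Ω → Fin p → ℝ) (hy : ∀ ω, y ω = C *ᵥ x' ω + v ω)
    (ν : Ω → Fin p → ℝ) (hν : ∀ ω, ν ω = y ω - C *ᵥ (A *ᵥ xc ω + B *ᵥ u ω)) :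
    Indep (MeasurableSpace.comap ν inferInstance) G (_mΩ := F) μ ∧
      IsGaussianMeasure (@Measure.map Ω (Fin p → ℝ) F _ ν μ) 0 (C * (A * Y * Aᵀ + W) * Cᵀ + V) := by
  have hνe : ∀ ω, ν ω = (C * A) *ᵥ (x ω - xc ω) + C *ᵥ w ω + v ω := fun ω => by
    rw [hν, hy, hx', ← mulVec_mulVec]
    simp only [mulVec_add, mulVec_sub]
    abel
  have hxcF : Measurable[F] xc := hxcm.mono hG le_rfl
  have hνm : Measurable[F] ν := by
    rw [funext hνe]
    unfold mulVec dotProduct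
    fun_prop
  refine indep_and_isGaussianMeasure_of_setIntegral hνm fun t s hs => ?_
  set a : Fin n → ℝ := t ᵥ* (C * A) with ha
  set b : Fin n → ℝ := t ᵥ* C with hb
  have hdecomp : ∀ ω, t ⬝ᵥ ν ω = b ⬝ᵥ w ω + t ⬝ᵥ v ω + (-(a ⬝ᵥ xc ω) + a ⬝ᵥ x ω) := fun ω => by
    rw [hνe, dotProduct_add, dotProduct_add, dotProduct_mulVec, dotProduct_mulVec, dotProduct_sub]
    ring
  let g : Ω → ℂ := fun ω => Complex.exp (Complex.I * ((-(a ⬝ᵥ xc ω) : ℝ) : ℂ))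
  let e : Ω → ℂ := fun ω => Complex.exp (Complex.I * ((a ⬝ᵥ x ω : ℝ) : ℂ))
  have hgm : Measurable[G] g := by
    have := hxcm.dotProduct_const_left a
    fun_prop
  have hge : ∀ ω, g ω * e ω
      = Complex.exp (Complex.I * ((-(a ⬝ᵥ xc ω) + a ⬝ᵥ x ω : ℝ) : ℂ)) := fun ω => by
    rw [← Complex.exp_add, ← mul_add, ← Complex.ofReal_add]
  have hxa := hxm.dotProduct_const_left a
  have hxca := hxcF.dotProduct_const_left a
  have hcond : ∫ ω in s, g ω * e ω ∂μ
      = μ.real s * Complex.exp (-(1 / 2 : ℂ) * ((a ⬝ᵥ (Y *ᵥ a) : ℝ) : ℂ)) := by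
    rw [setIntegral_mul_condExp hG hgm.stronglyMeasurable (integrable_cexp_I_mul hxa)
      ((integrable_cexp_I_mul (hxca.neg.add hxa)).congr (ae_of_all _ fun ω => (hge ω).symm)) hs]
    have : ∫ ω in s, g ω * (μ[e | G]) ω ∂μ
        = ∫ _ in s, Complex.exp (-(1 / 2 : ℂ) * ((a ⬝ᵥ (Y *ᵥ a) : ℝ) : ℂ)) ∂μ := by
      refine setIntegral_congr_ae (hG s hs) ?_
      filter_upwards [hxGauss a] with ω hω _
      rw [show (μ[e | G]) ω = _ from hω, ← Complex.exp_add]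
      congr 1
      push_cast
      ring
    rw [this, setIntegral_const, Complex.real_smul]
  have hxG : Measurable[G ⊔ MeasurableSpace.comap x inferInstance] x :=
    (comap_measurable x).mono le_sup_right le_rfl
  have hsG : MeasurableSet[G ⊔ MeasurableSpace.comap x inferInstance] s :=
    (le_sup_left : G ≤ G ⊔ MeasurableSpace.comap x inferInstance) s hs
  have hprod := hindep.integral_mul_mul hwm.comap_le hvm.comap_le (sup_le hG hxm.comap_le)
    (f₁ := fun ω => Complex.exp (Complex.I * ((b ⬝ᵥ w ω : ℝ) : ℂ)))
    (f₂ := fun ω => Complex.exp (Complex.I * ((t ⬝ᵥ v ω : ℝ) : ℂ)))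
    (f₃ := s.indicator fun ω => g ω * e ω)
    (by
      have := (comap_measurable w).dotProduct_const_left b
      fun_prop)
    (by
      have := (comap_measurable v).dotProduct_const_left t
      fun_prop)
    (by
      have hg' := hgm.mono (le_sup_left : G ≤ G ⊔ MeasurableSpace.comap x inferInstance) le_rfl
      have := hxG.dotProduct_const_left a
      exact Measurable.indicator (by fun_prop) hsG)
  rw [integral_indicator (hG s hs), hcond, hwGauss.integral_comp hwm,
    hvGauss.integral_comp hvm] at hprod
  have hquad : t ⬝ᵥ ((C * (A * Y * Aᵀ + W) * Cᵀ + V) *ᵥ t)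
      = b ⬝ᵥ (W *ᵥ b) + t ⬝ᵥ (V *ᵥ t) + a ⬝ᵥ (Y *ᵥ a) := by
    have hat : a = Aᵀ *ᵥ (Cᵀ *ᵥ t) := by
      rw [ha, ← mulVec_transpose, transpose_mul, mulVec_mulVec]
    have hbt : b = Cᵀ *ᵥ t := by rw [hb, mulVec_transpose]
    have h1 : a ⬝ᵥ (Y *ᵥ a) = t ⬝ᵥ ((C * (A * Y * Aᵀ) * Cᵀ) *ᵥ t) := by
      rw [show a ⬝ᵥ (Y *ᵥ a) = t ⬝ᵥ ((C * A) *ᵥ (Y *ᵥ a)) from (dotProduct_mulVec ..).symm, hat]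
      simp only [mulVec_mulVec, Matrix.mul_assoc]
    have h2 : b ⬝ᵥ (W *ᵥ b) = t ⬝ᵥ ((C * W * Cᵀ) *ᵥ t) := by
      rw [show b ⬝ᵥ (W *ᵥ b) = t ⬝ᵥ (C *ᵥ (W *ᵥ b)) from (dotProduct_mulVec ..).symm, hbt]
      simp only [mulVec_mulVec, Matrix.mul_assoc]
    rw [h1, h2, Matrix.mul_add, Matrix.add_mul, add_mulVec, add_mulVec, dotProduct_add,
      dotProduct_add]
    ring
  rw [← integral_indicator (hG s hs)]
  calc _ = _ := integral_congr_ae (ae_of_all _ fun ω => ?_)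
    _ = _ := hprod
    _ = _ := ?_
  · by_cases hω : ω ∈ s
    · simp only [Set.indicator_of_mem hω, hge]
      rw [← Complex.exp_add, ← Complex.exp_add, hdecomp]
      congr 1
      push_cast
      ring
    · simp [Set.indicator_of_notMem hω]
  · rw [hquad, mul_left_comm, ← Complex.exp_add, ← Complex.exp_add]
    congr 2
    push_cast
    ring
end
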